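/- With H the reduced (row/column t removed) weighted Laplacian of a tree with edge weights 1/r_e, for any non-root nodes a, b: H⁻¹(a,a) + H⁻¹(b,b) − 2H⁻¹(a,b) = Σ_{e ∈ P_ab} r_e, the sum of r_e along the unique path from a to b (the effective resistance). -/

import Mathlib

open SimpleGraph in
theorem aux_step {V : Type*} [DecidableEq V] (G : SimpleGraph V) (hT : G.IsTree)
    (r : Sym2 V → ℝ) (d : V → V → ℝ)
    (hd : ∀ (a b : V) (p : G.Walk a b), p.IsPath → (p.edges.map r).sum = d a b)
    (x b : V) (hxb : x ≠ b) :
    ∃ c0, G.Adj x c0 ∧ d x b = r s(x, c0) + d c0 b ∧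
      ∀ c, G.Adj x c → c ≠ c0 → d c b = r s(x, c) + d x b := by
  obtain ⟨p, hp, -⟩ := hT.existsUnique_path x b
  cases p with
  | nil => exact absurd rfl hxb
  | @cons _ c0 _ h q =>
    have hq := hp.of_cons
    refine ⟨c0, h, ?_, ?_⟩
    · rw [← hd _ _ _ hp, ← hd _ _ _ hq]
      simp
    · intro c hc hne
      have hns : c ∉ (Walk.cons h q).support := by
        intro hmem
        have h1 : ((Walk.cons h q).takeUntil c hmem).IsPath := hp.takeUntil hmem
        have h2 : (Walk.cons hc Walk.nil : G.Walk x c).IsPath := by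
          simp [Walk.cons_isPath_iff, hc.ne]
        have h3 : (Walk.cons h q).takeUntil c hmem = Walk.cons hc Walk.nil :=
          (hT.existsUnique_path x c).unique h1 h2
        have h4 := (Walk.cons h q).take_spec hmem
        rw [h3] at h4
        have h5 := congrArg Walk.snd h4
        simp at h5
        exact hne h5
      have hp' : (Walk.cons hc.symm (Walk.cons h q)).IsPath := hp.cons hns
      rw [← hd _ _ _ hp', ← hd _ _ _ hp, Walk.edges_cons, List.map_cons, List.sum_cons,
        Sym2.eq_swap]

open SimpleGraph in
theorem aux_sum {V : Type*} [Fintype V] [DecidableEq V] (G : SimpleGraph V) [DecidableRel G.Adj]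
    (hT : G.IsTree)
    (r : Sym2 V → ℝ) (hr : ∀ e ∈ G.edgeSet, 0 < r e) (d : V → V → ℝ)
    (hd : ∀ (a b : V) (p : G.Walk a b), p.IsPath → (p.edges.map r).sum = d a b)
    (x b : V) :
    ∑ c ∈ G.neighborFinset x, (r s(x, c))⁻¹ * (d x b - d c b)
      = (if x = b then 0 else 2) - (G.neighborFinset x).card := by
  have hd0 : d x x = 0 := by rw [← hd x x Walk.nil (by simp)]; simp
  have hne : ∀ c ∈ G.neighborFinset x, r s(x, c) ≠ 0 := fun c hc =>
    (hr _ (by simpa using hc)).ne'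
  by_cases hxb : x = b
  · subst hxb
    rw [Finset.sum_congr rfl (g := fun _ => (-1 : ℝ))]
    · simp
    · intro c hc
      have hc' : G.Adj x c := by simpa using hc
      have h1 : d c x = r s(x, c) := by
        rw [← hd c x (Walk.cons hc'.symm Walk.nil) (by simp [Walk.cons_isPath_iff, hc'.ne'])]
        simp [Sym2.eq_swap]
      have := hne c hc
      rw [hd0, h1]; field_simp; simp
  · obtain ⟨c0, h0, h1, h2⟩ := aux_step G hT r d hd x b hxb
    rw [Finset.sum_congr rfl (g := fun c => (if c = c0 then (2 : ℝ) else 0) - 1)]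
    · rw [Finset.sum_sub_distrib, Finset.sum_ite_eq']
      simp [h0, hxb]
    · intro c hc
      have := hne c hc
      by_cases h : c = c0
      · subst h
        rw [h1]; simp [this]; norm_num
      · rw [h2 c (by simpa using hc) h]; simp [h, this]

/-- With `H` the reduced (at root `t`) weighted Laplacian of a tree with edge
weights `1/r_e`: `H⁻¹ a a + H⁻¹ b b - 2 H⁻¹ a b` equals the effective
resistance, i.e. the sum of `r_e` along the unique path from `a` to `b`. -/
theorem stmt5 {V : Type*} [Fintype V] [DecidableEq V]
    (G : SimpleGraph V) [DecidableRel G.Adj] (hT : G.IsTree)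
    (t : V) (r : Sym2 V → ℝ) (hr : ∀ e ∈ G.edgeSet, 0 < r e)
    (L : Matrix V V ℝ)
    (hL : ∀ a b : V, L a b =
      if a = b then ∑ c ∈ G.neighborFinset a, (r s(a, c))⁻¹
      else if G.Adj a b then -(r s(a, b))⁻¹ else 0)
    (H : Matrix {v : V // v ≠ t} {v : V // v ≠ t} ℝ)
    (hH : ∀ a b : {v : V // v ≠ t}, H a b = L a.1 b.1) :
    ∀ (a b : {v : V // v ≠ t}) (p : G.Walk a.1 b.1), p.IsPath →
      H⁻¹ a a + H⁻¹ b b - 2 * H⁻¹ a b = (p.edges.map r).sum := by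
  obtain ⟨d, hd⟩ : ∃ d : V → V → ℝ,
      ∀ (a b : V) (p : G.Walk a b), p.IsPath → (p.edges.map r).sum = d a b := by
    choose P hP hP' using fun a b => hT.existsUnique_path a b
    exact ⟨fun a b => ((P a b).edges.map r).sum, fun a b p hp => by rw [hP' a b p hp]⟩
  have hd0 : ∀ x, d x x = 0 := fun x => by
    rw [← hd x x SimpleGraph.Walk.nil (by simp)]; simp
  have hsymm : ∀ x y, d x y = d y x := fun x y => by
    obtain ⟨p, hp, -⟩ := hT.existsUnique_path x y
    rw [← hd x y p hp, ← hd y x p.reverse hp.reverse, SimpleGraph.Walk.edges_reverse,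
      List.map_reverse, List.sum_reverse]
  have hLs : ∀ (x : V) (f : V → ℝ), ∑ y, L x y * f y =
      ∑ c ∈ G.neighborFinset x, (r s(x, c))⁻¹ * (f x - f c) := by
    intro x f
    have h1 : ∀ y, L x y * f y = (if x = y then (∑ c ∈ G.neighborFinset x, (r s(x, c))⁻¹) * f x
        else 0) - (if G.Adj x y then (r s(x, y))⁻¹ * f y else 0) := by
      intro y
      rw [hL]
      by_cases h : x = y
      · subst h; simp
      · by_cases h' : G.Adj x y <;> simp [h, h']
    simp_rw [h1, mul_sub]
    rw [Finset.sum_sub_distrib, Finset.sum_sub_distrib, Finset.sum_ite_eq, ← Finset.sum_filter,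
      ← Finset.sum_mul, SimpleGraph.neighborFinset_eq_filter]
    simp
  let M : V → V → ℝ := fun a b => (d a t + d b t - d a b) / 2
  have hM : H * Matrix.of (fun a b : {v : V // v ≠ t} => M a.1 b.1) = 1 := by
    ext x b
    rw [Matrix.mul_apply]
    simp only [hH, Matrix.of_apply]
    have h1 : ∑ y : {v : V // v ≠ t}, L x.1 y.1 * M y.1 b.1 = ∑ y, L x.1 y * M y b.1 := by
      have h0 : M t b.1 = 0 := by simp [M, hd0, hsymm b.1 t]
      rw [← Finset.add_sum_erase _ _ (Finset.mem_univ t), h0, mul_zero, zero_add]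
      exact (Finset.sum_subtype (Finset.univ.erase t) (p := fun v => v ≠ t) (by simp)
        (fun y => L x.1 y * M y b.1)).symm
    rw [h1, hLs]
    have h2 := aux_sum G hT r hr d hd x.1 t
    have h3 := aux_sum G hT r hr d hd x.1 b.1
    have h4 : ∑ c ∈ G.neighborFinset x.1, (r s(x.1, c))⁻¹ * (M x.1 b.1 - M c b.1) =
      (∑ c ∈ G.neighborFinset x.1, (r s(x.1, c))⁻¹ * (d x.1 t - d c t)
       - ∑ c ∈ G.neighborFinset x.1, (r s(x.1, c))⁻¹ * (d x.1 b.1 - d c b.1)) / 2 := by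
      rw [← Finset.sum_sub_distrib, Finset.sum_div]
      refine Finset.sum_congr rfl fun c _ => ?_
      simp only [M]; ring
    rw [h4, h2, h3, if_neg x.2, Matrix.one_apply]
    by_cases h : x = b
    · simp [h]
    · have : x.1 ≠ b.1 := fun h' => h (Subtype.ext h')
      simp [h, this]
  intro a b p hp
  rw [Matrix.inv_eq_right_inv hM, hd _ _ p hp]
  simp only [Matrix.of_apply, M, hd0]
  ring
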